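/- Let Ω ⊆ ℝⁿ be a bounded open set satisfying the quantitative cone condition with parameters c > 0 and r > 0, let 0 < β ≤ 1 and C_β > 0, and let u : closure(Ω) → ℝ be (β, C_β)-Hölder continuous. Let s > 0 and K > 0 and assume the structural condition: for every x ∈ closure(Ω) and every radius R with 0 < R ≤ r, s · ∫_{Ω ∩ B(x,R)} |λ(u(y))| dy ≤ K·Rⁿ. Then sup_{x ∈ closure(Ω)} |λ(u(x))| ≤ (2K/c) · s^{−1}. -/

import Mathlib

open MeasureTheory

/-- The penalisation function `λ(t) = max(t-1, 0) + min(t+1, 0)`. -/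
noncomputable def lam (t : ℝ) : ℝ := max (t - 1) 0 + min (t + 1) 0

/-- `u` is `(β, Cβ)`-Hölder continuous on `A ⊆ ℝⁿ`. -/
def IsHolderOn {n : ℕ} (β Cβ : ℝ) (A : Set (EuclideanSpace ℝ (Fin n)))
    (u : EuclideanSpace ℝ (Fin n) → ℝ) : Prop :=
  ∀ x ∈ A, ∀ y ∈ A, |u x - u y| ≤ Cβ * ‖x - y‖ ^ β

/-- `Ω` satisfies the quantitative cone condition with parameters `c, r`. -/
def ConeCondition {n : ℕ} (Ω : Set (EuclideanSpace ℝ (Fin n))) (c r : ℝ) : Prop :=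
  ∀ x ∈ closure Ω, ∀ R : ℝ, 0 < R → R ≤ r →
    ∃ S : Set (EuclideanSpace ℝ (Fin n)), MeasurableSet S ∧
      S ⊆ Ω ∩ Metric.ball x R ∧ c * R ^ n ≤ (volume S).toReal

theorem abs_lam_sub_le (a b : ℝ) : |lam a - lam b| ≤ |a - b| := by
  have h := le_abs_self (a - b)
  have h' := neg_abs_le (a - b)
  unfold lam
  rw [abs_le]
  constructor <;>
  rcases max_cases (a - 1) 0 with ⟨h1, _⟩ | ⟨h1, _⟩ <;>
  rcases max_cases (b - 1) 0 with ⟨h2, _⟩ | ⟨h2, _⟩ <;>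
  rcases min_cases (a + 1) 0 with ⟨h3, _⟩ | ⟨h3, _⟩ <;>
  rcases min_cases (b + 1) 0 with ⟨h4, _⟩ | ⟨h4, _⟩ <;>
  rw [h1, h2, h3, h4] <;> linarith

theorem continuous_lam : Continuous lam := by
  unfold lam
  fun_prop

theorem IsHolderOn.continuousOn {n : ℕ} {β Cβ : ℝ} {A : Set (EuclideanSpace ℝ (Fin n))}
    {u : EuclideanSpace ℝ (Fin n) → ℝ} (hu : IsHolderOn β Cβ A u) (hβ : 0 < β) :
    ContinuousOn u A := by
  intro x hx
  refine tendsto_iff_dist_tendsto_zero.2 (squeeze_zero' (g := fun y => Cβ * ‖y - x‖ ^ β)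
    (.of_forall fun _ => dist_nonneg) ?_ ?_)
  · filter_upwards [self_mem_nhdsWithin] with y hy
    exact hu y hy x hx
  · have h : Continuous fun y : EuclideanSpace ℝ (Fin n) => Cβ * ‖y - x‖ ^ β :=
      continuous_const.mul ((continuous_id.sub continuous_const).norm.rpow_const
        fun _ => Or.inr hβ.le)
    have := (h.tendsto x).mono_left (nhdsWithin_le_nhds (s := A))
    simpa [Real.zero_rpow hβ.ne'] using this

/-- Improved `L∞` bound under the structural assumption: if the mass of the violation
in any ball of radius `R ≤ r` is at most `K·Rⁿ/s`, then
`sup_{closure Ω} |λ(u)| ≤ (2K/c)·s⁻¹`. -/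
theorem sup_decay_structural {n : ℕ} (Ω : Set (EuclideanSpace ℝ (Fin n)))
    (hΩo : IsOpen Ω) (hΩb : Bornology.IsBounded Ω)
    (c r : ℝ) (hc : 0 < c) (hr : 0 < r) (hcone : ConeCondition Ω c r)
    (β Cβ : ℝ) (hβ : 0 < β) (hβ1 : β ≤ 1) (hCβ : 0 < Cβ)
    (u : EuclideanSpace ℝ (Fin n) → ℝ) (hu : IsHolderOn β Cβ (closure Ω) u)
    (s K : ℝ) (hs : 0 < s) (hK : 0 < K)
    (hstruct : ∀ x ∈ closure Ω, ∀ R : ℝ, 0 < R → R ≤ r →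
      s * ∫ y in Ω ∩ Metric.ball x R, |lam (u y)| ≤ K * R ^ n) :
    sSup ((fun x => |lam (u x)|) '' closure Ω) ≤ 2 * K / c * s⁻¹ := by
  refine Real.sSup_le ?_ (by positivity)
  rintro _ ⟨x, hx, rfl⟩
  set M := |lam (u x)| with hM
  change M ≤ _
  rcases (abs_nonneg (lam (u x))).eq_or_lt with h0 | hpos
  · rw [hM, ← h0]; positivity
  rw [← hM] at hpos
  set R := min r ((M / (2 * Cβ)) ^ β⁻¹) with hR
  have hRpos : 0 < R := lt_min hr (by positivity)
  have hRr : R ≤ r := min_le_left _ _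
  have hdev : ∀ y ∈ Ω ∩ Metric.ball x R, |lam (u y) - lam (u x)| ≤ M / 2 := by
    rintro y ⟨hy, hyR⟩
    have hnorm : ‖y - x‖ ≤ (M / (2 * Cβ)) ^ β⁻¹ :=
      (mem_ball_iff_norm.1 hyR).le.trans (min_le_right _ _)
    calc |lam (u y) - lam (u x)| ≤ |u y - u x| := abs_lam_sub_le _ _
      _ ≤ Cβ * ‖y - x‖ ^ β := hu y (subset_closure hy) x hx
      _ ≤ Cβ * ((M / (2 * Cβ)) ^ β⁻¹) ^ β := by gcongr
      _ = M / 2 := by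
        rw [Real.rpow_inv_rpow (by positivity) hβ.ne']
        field_simp
  have hmeas : MeasurableSet (Ω ∩ Metric.ball x R) :=
    hΩo.measurableSet.inter measurableSet_ball
  have hfin : volume (Ω ∩ Metric.ball x R) < ⊤ :=
    (measure_mono Set.inter_subset_right).trans_lt measure_ball_lt_top
  have hint : IntegrableOn (fun y => |lam (u y)|) (Ω ∩ Metric.ball x R) := by
    refine ⟨?_, .restrict_of_bounded (C := M + M / 2) hfin ?_⟩
    · exact ((continuous_abs.comp continuous_lam).comp_continuousOn
        ((hu.continuousOn hβ).mono
          (Set.inter_subset_left.trans subset_closure))).aestronglyMeasurable hmeas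
    · refine (ae_restrict_iff' hmeas).2 (.of_forall fun y hy => ?_)
      have := abs_sub_abs_le_abs_sub (lam (u y)) (lam (u x))
      rw [Real.norm_eq_abs, abs_abs]
      linarith [hdev y hy]
  obtain ⟨S, hSm, hSsub, hSvol⟩ := hcone x hx R hRpos hRr
  have hlow : M / 2 * (volume S).toReal ≤ ∫ y in S, |lam (u y)| := by
    refine setIntegral_ge_of_const_le_real hSm
      ((measure_mono hSsub).trans_lt hfin).ne (fun y hy => ?_) (hint.mono_set hSsub)
    have := abs_sub_abs_le_abs_sub (lam (u x)) (lam (u y))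
    rw [abs_sub_comm] at this
    linarith [hdev y (hSsub hy)]
  have hmono : ∫ y in S, |lam (u y)| ≤ ∫ y in Ω ∩ Metric.ball x R, |lam (u y)| :=
    setIntegral_mono_set hint (.of_forall fun _ => abs_nonneg _) hSsub.eventuallyLE
  have hkey : s * (M / 2 * c) * R ^ n ≤ K * R ^ n :=
    calc s * (M / 2 * c) * R ^ n = s * (M / 2 * (c * R ^ n)) := by ring
      _ ≤ s * (M / 2 * (volume S).toReal) := by gcongr
      _ ≤ s * ∫ y in Ω ∩ Metric.ball x R, |lam (u y)| := by gcongr; exact hlow.trans hmono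
      _ ≤ K * R ^ n := hstruct x hx R hRpos hRr
  have := le_of_mul_le_mul_right hkey (by positivity)
  rw [← div_eq_mul_inv, div_div, le_div_iff₀ (by positivity)]
  linarith
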